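/- arXiv:1603.08762 — 5 statements merged into one kernel-verified Lean document; each statement's English description precedes it below -/
import Mathlib

section
/- Let (λ_n)_{n∈ℤ} be a sequence of real numbers. Then for every finitely supported sequence (c_n)_{n∈ℤ} of complex numbers, ∫_ℝ |Σ_{n∈ℤ} c_n (sinc(n − ξ) − sinc(λ_n − ξ))|² dξ = (1/(2π)) ∫_{−π}^{π} |Σ_{n∈ℤ} c_n (e^{int} − e^{iλ_n t})|² dt. -/
open MeasureTheory

/-- The normalized sinc function: `sinc x = sin (π x) / (π x)` for `x ≠ 0`, `sinc 0 = 1`. -/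
noncomputable def sincFun (x : ℝ) : ℝ :=
  if x = 0 then 1 else Real.sin (Real.pi * x) / (Real.pi * x)

open scoped FourierTransform ContDiff

section Plancherel

variable {V E : Type*} [NormedAddCommGroup V] [InnerProductSpace ℝ V] [FiniteDimensional ℝ V]
  [MeasurableSpace V] [BorelSpace V] [NormedAddCommGroup E] [InnerProductSpace ℂ E]

/-- The Fourier integral of an integrable function is continuous. -/
theorem continuous_fourier_of_integrable {f : V → E} (hf : Integrable f) : Continuous (𝓕 f) :=
  VectorFourier.fourierIntegral_continuous Real.continuous_fourierChar
    (innerSL ℝ).continuous₂ hf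

/-- The squared `L²` norm as an integral. -/
theorem MeasureTheory.Lp.norm_sq_eq_integral {α : Type*} [MeasurableSpace α] {μ : Measure α}
    (f : Lp E 2 μ) : ‖f‖ ^ 2 = ∫ x, ‖f x‖ ^ 2 ∂μ := by
  have h : ((‖f‖ ^ 2 : ℝ) : ℂ) = ((∫ x, ‖f x‖ ^ 2 ∂μ : ℝ) : ℂ) := by
    rw [← integral_complex_ofReal]
    simpa [inner_self_eq_norm_sq_to_K] using L2.inner_def (𝕜 := ℂ) f f
  exact_mod_cast h

variable [CompleteSpace E]

/-- The `L²` Fourier transform of an integrable square-integrable function is given by the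
Fourier integral. -/
theorem coeFn_fourier_toLp_ae_eq {f : V → E} (hf : Integrable f) (hf2 : MemLp f 2) :
    (𝓕 (hf2.toLp f) : Lp E 2 (volume : Measure V)) =ᵐ[volume] 𝓕 f := by
  refine ae_eq_of_integral_contDiff_smul_eq
    ((Lp.memLp (𝓕 (hf2.toLp f))).locallyIntegrable one_le_two)
    (continuous_fourier_of_integrable hf).locallyIntegrable fun g hg hg_cpt ↦ ?_
  have hg₁ : HasCompactSupport (Complex.ofRealCLM ∘ g) := hg_cpt.comp_left rfl
  have hg₂ : ContDiff ℝ ∞ (Complex.ofRealCLM ∘ g) := by fun_prop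
  let φ : SchwartzMap V ℂ := hg₁.toSchwartzMap hg₂
  calc
    ∫ x, g x • (𝓕 (hf2.toLp f) : Lp E 2 (volume : Measure V)) x
        = Lp.toTemperedDistribution (𝓕 (hf2.toLp f)) φ := by simp [φ]
    _ = ∫ x, 𝓕 (φ : V → ℂ) x • (hf2.toLp f) x := by
      rw [← Lp.fourier_toTemperedDistribution_eq, TemperedDistribution.fourier_apply,
        Lp.toTemperedDistribution_apply, SchwartzMap.fourier_coe]
    _ = ∫ x, 𝓕 (φ : V → ℂ) x • f x := by
      refine integral_congr_ae ?_
      filter_upwards [hf2.coeFn_toLp] with x hx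
      rw [hx]
    _ = ∫ x, φ x • 𝓕 f x := by
      have h := VectorFourier.integral_fourierIntegral_smul_eq_flip (L := innerₗ V)
        Real.continuous_fourierChar continuous_inner (φ.integrable (μ := volume)) hf
      rwa [flip_innerₗ] at h
    _ = ∫ x, g x • 𝓕 f x := by simp [φ]

/-- Plancherel's theorem for integrable square-integrable functions. -/
theorem integral_norm_sq_fourier_eq {f : V → E} (hf : Integrable f) (hf2 : MemLp f 2) :
    ∫ ξ, ‖𝓕 f ξ‖ ^ 2 = ∫ x, ‖f x‖ ^ 2 := by
  calc
    ∫ ξ, ‖𝓕 f ξ‖ ^ 2 = ∫ ξ, ‖(𝓕 (hf2.toLp f) : Lp E 2 (volume : Measure V)) ξ‖ ^ 2 := by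
      refine integral_congr_ae ?_
      filter_upwards [coeFn_fourier_toLp_ae_eq hf hf2] with x hx
      rw [hx]
    _ = ∫ x, ‖hf2.toLp f x‖ ^ 2 := by
      rw [← Lp.norm_sq_eq_integral, ← Lp.norm_sq_eq_integral, Lp.norm_fourier_eq]
    _ = ∫ x, ‖f x‖ ^ 2 := by
      refine integral_congr_ae ?_
      filter_upwards [hf2.coeFn_toLp] with x hx
      rw [hx]

end Plancherel

/-- The normalized sinc function is the Fourier integral of the unit interval. -/
theorem intervalIntegral_exp_eq_sincFun (a : ℝ) :
    ∫ x in (-(1 / 2) : ℝ)..1 / 2, Complex.exp (2 * Real.pi * a * Complex.I * x) = sincFun a := by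
  rcases eq_or_ne a 0 with rfl | ha
  · norm_num [sincFun]
  have hπ : (Real.pi : ℂ) ≠ 0 := by exact_mod_cast Real.pi_ne_zero
  have ha' : (a : ℂ) ≠ 0 := by exact_mod_cast ha
  rw [integral_exp_mul_complex (by simp [hπ, ha'])]
  have h₁ : 2 * Real.pi * a * Complex.I * ((1 / 2 : ℝ) : ℂ) = (Real.pi * a : ℂ) * Complex.I := by
    push_cast; ring
  have h₂ : 2 * Real.pi * a * Complex.I * ((-(1 / 2) : ℝ) : ℂ)
      = -(Real.pi * a : ℂ) * Complex.I := by
    push_cast; ring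
  rw [h₁, h₂]
  simp only [sincFun, ha, if_false]
  push_cast
  rw [Complex.sin]
  field_simp
  rw [Complex.I_sq]
  ring

/-- The Fourier integral of a combination of differences of exponentials, cut off to the unit
interval, is the corresponding combination of differences of translated sinc functions. -/
theorem fourier_indicator_sum_exp {ι : Type*} (s : Finset ι) (c : ι → ℂ) (a b : ι → ℝ) (ξ : ℝ) :
    𝓕 ((Set.Ioc (-(1 / 2) : ℝ) (1 / 2)).indicator fun x : ℝ ↦ ∑ n ∈ s,
      c n * (Complex.exp (Complex.I * a n * (2 * Real.pi * x : ℝ))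
        - Complex.exp (Complex.I * b n * (2 * Real.pi * x : ℝ)))) ξ
      = ∑ n ∈ s, c n * ((sincFun (a n - ξ) : ℂ) - (sincFun (b n - ξ) : ℂ)) := by
  rw [Real.fourier_real_eq_integral_exp_smul]
  simp_rw [← Set.indicator_smul_apply _
    (fun x : ℝ ↦ Complex.exp (↑(-2 * Real.pi * x * ξ) * Complex.I))]
  rw [integral_indicator measurableSet_Ioc, ← intervalIntegral.integral_of_le (by norm_num)]
  have h : ∀ x : ℝ, Complex.exp (↑(-2 * Real.pi * x * ξ) * Complex.I) • (∑ n ∈ s,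
      c n * (Complex.exp (Complex.I * a n * (2 * Real.pi * x : ℝ))
        - Complex.exp (Complex.I * b n * (2 * Real.pi * x : ℝ))))
      = ∑ n ∈ s, c n * (Complex.exp (2 * Real.pi * (a n - ξ : ℝ) * Complex.I * x)
        - Complex.exp (2 * Real.pi * (b n - ξ : ℝ) * Complex.I * x)) := fun x ↦ by
    rw [smul_eq_mul, Finset.mul_sum]
    refine Finset.sum_congr rfl fun n _ ↦ ?_
    rw [mul_left_comm, mul_sub, ← Complex.exp_add, ← Complex.exp_add]
    push_cast
    ring_nf
  simp_rw [h]
  rw [intervalIntegral.integral_finsetSum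
    fun n _ ↦ Continuous.intervalIntegrable (by fun_prop) _ _]
  refine Finset.sum_congr rfl fun n _ ↦ ?_
  rw [intervalIntegral.integral_const_mul, intervalIntegral.integral_sub
    (Continuous.intervalIntegrable (by fun_prop) _ _)
    (Continuous.intervalIntegrable (by fun_prop) _ _),
    intervalIntegral_exp_eq_sincFun, intervalIntegral_exp_eq_sincFun]

/-- For real `λ_n` and any finitely supported complex `(c_n)`,
`∫_ℝ |Σ_n c_n (sinc(n - ξ) - sinc(λ_n - ξ))|² dξ
  = (1/(2π)) ∫_{-π}^{π} |Σ_n c_n (e^{int} - e^{iλ_n t})|² dt`. -/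
theorem sinc_exponential_transfer (lam : ℤ → ℝ) (c : ℤ →₀ ℂ) :
    (∫ ξ : ℝ,
        ‖∑ n ∈ c.support, c n * ((sincFun ((n : ℝ) - ξ) : ℂ) - (sincFun (lam n - ξ) : ℂ))‖ ^ 2)
      = (1 / (2 * Real.pi)) * ∫ t in (-Real.pi)..Real.pi,
          ‖∑ n ∈ c.support,
              c n * (Complex.exp (Complex.I * n * t) - Complex.exp (Complex.I * (lam n) * t))‖ ^ 2 := by
  let G : ℝ → ℂ := fun t ↦ ∑ n ∈ c.support,
    c n * (Complex.exp (Complex.I * n * t) - Complex.exp (Complex.I * (lam n) * t))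
  let f : ℝ → ℂ := (Set.Ioc (-(1 / 2) : ℝ) (1 / 2)).indicator fun x ↦ G (2 * Real.pi * x)
  have hG : Continuous fun x ↦ G (2 * Real.pi * x) := by fun_prop
  have hf : ∀ p, MemLp f p := fun p ↦ by
    rw [memLp_indicator_iff_restrict measurableSet_Ioc]
    obtain ⟨C, hC⟩ := (isCompact_Icc (a := (-(1 / 2) : ℝ)) (b := 1 / 2)).exists_bound_of_continuousOn
      hG.continuousOn
    refine MemLp.of_bound hG.aestronglyMeasurable C ?_
    filter_upwards [ae_restrict_mem measurableSet_Ioc] with x hx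
    exact hC x (Set.Ioc_subset_Icc_self hx)
  calc
    _ = ∫ ξ, ‖𝓕 f ξ‖ ^ 2 := by
      refine integral_congr_ae (.of_forall fun ξ ↦ ?_)
      have h := fourier_indicator_sum_exp c.support c (fun n ↦ (n : ℝ)) lam ξ
      simp only [Complex.ofReal_intCast] at h
      exact congrArg (‖·‖ ^ 2) h.symm
    _ = ∫ x, ‖f x‖ ^ 2 := integral_norm_sq_fourier_eq (memLp_one_iff_integrable.1 (hf 1)) (hf 2)
    _ = ∫ x in (-(1 / 2) : ℝ)..1 / 2, ‖G (2 * Real.pi * x)‖ ^ 2 := by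
      rw [intervalIntegral.integral_of_le (by norm_num), ← integral_indicator measurableSet_Ioc]
      refine integral_congr_ae (.of_forall fun x ↦ ?_)
      by_cases hx : x ∈ Set.Ioc (-(1 / 2) : ℝ) (1 / 2) <;> simp only [f, hx, Set.indicator_of_mem,
        Set.indicator_of_notMem, not_false_eq_true, norm_zero, ne_eq, OfNat.ofNat_ne_zero, zero_pow]
    _ = (1 / (2 * Real.pi)) * ∫ t in (-Real.pi)..Real.pi, ‖G t‖ ^ 2 := by
      rw [intervalIntegral.integral_comp_mul_left (fun t ↦ ‖G t‖ ^ 2) (by positivity),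
        smul_eq_mul, one_div (2 * Real.pi)]
      congr 2 <;> ring
end

section
/- Let (λ_n)_{n∈ℤ} be a sequence of real numbers. Then for every finitely supported sequence (c_n)_{n∈ℤ} of complex numbers with Σ_{n∈ℤ} |c_n|² ≤ 1, one has ∫_ℝ |Σ_{n∈ℤ} c_n (sinc(λ_n − t) − sinc(n − t))|² dt ≤ 2 Σ_{n∈ℤ} (1 − sinc(λ_n − n)). -/
open MeasureTheory

theorem sincFun_eq_sinc (x : ℝ) : sincFun x = Real.sinc (Real.pi * x) := by
  simp [sincFun, Real.sinc, Real.pi_ne_zero]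

theorem continuous_sincFun : Continuous sincFun := by
  rw [funext sincFun_eq_sinc]
  fun_prop

theorem sincFun_le_one (x : ℝ) : sincFun x ≤ 1 :=
  sincFun_eq_sinc x ▸ Real.sinc_le_one _

theorem integral_cexp_eq_sincFun (x : ℝ) :
    ∫ ξ in (-(1 / 2) : ℝ)..(1 / 2), Complex.exp ((2 * Real.pi * x * ξ : ℝ) * Complex.I)
      = sincFun x := by
  rcases eq_or_ne x 0 with rfl | hx
  · norm_num [sincFun]
  have hne : 2 * Real.pi * x ≠ 0 := mul_ne_zero (by positivity) hx
  rw [intervalIntegral.integral_comp_mul_left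
    (fun u : ℝ => Complex.exp (u * Complex.I)) hne, sincFun_eq_sinc]
  have h := integral_exp_mul_I_eq_sinc (Real.pi * x)
  rw [show 2 * Real.pi * x * -(1 / 2) = -(Real.pi * x) by ring,
    show 2 * Real.pi * x * (1 / 2) = Real.pi * x by ring, h, Complex.real_smul]
  have hpi : (Real.pi : ℂ) ≠ 0 := by exact_mod_cast Real.pi_ne_zero
  have hx' : (x : ℂ) ≠ 0 := by exact_mod_cast hx
  push_cast
  field_simp

theorem integral_cos_eq_sincFun (x : ℝ) :
    ∫ ξ in (-(1 / 2) : ℝ)..(1 / 2), Real.cos (2 * Real.pi * x * ξ) = sincFun x := by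
  have h := congrArg Complex.re (integral_cexp_eq_sincFun x)
  rw [← Complex.reCLM_apply, ← ContinuousLinearMap.intervalIntegral_comp_comm] at h
  · simpa only [Complex.reCLM_apply, Complex.exp_ofReal_mul_I_re, Complex.ofReal_re] using h
  · exact Continuous.intervalIntegrable (by fun_prop) _ _

theorem sq_norm_cexp_sub_cexp (θ φ : ℝ) :
    ‖Complex.exp (θ * Complex.I) - Complex.exp (φ * Complex.I)‖ ^ 2
      = 2 - 2 * Real.cos (θ - φ) := by
  rw [Complex.sq_norm, Complex.normSq_apply, Complex.sub_re, Complex.sub_im,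
    Complex.exp_ofReal_mul_I_re, Complex.exp_ofReal_mul_I_re, Complex.exp_ofReal_mul_I_im,
    Complex.exp_ofReal_mul_I_im, Real.cos_sub]
  linarith [Real.sin_sq_add_cos_sq θ, Real.sin_sq_add_cos_sq φ]

theorem lintegral_eq_lintegral_tsum_add_intCast {f : ℝ → ENNReal} (hf : Measurable f) :
    ∫⁻ t, f t = ∫⁻ t in Set.Ioc (0 : ℝ) 1, ∑' n : ℤ, f (t + n) := by
  rw [lintegral_tsum (f := fun (n : ℤ) t => f (t + n)) fun n =>
      (hf.comp (measurable_id.add_const (n : ℝ))).aemeasurable,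
    ← setLIntegral_univ, ← iUnion_Ioc_intCast ℝ,
    lintegral_iUnion (fun _ => measurableSet_Ioc) (Set.pairwise_disjoint_Ioc_intCast ℝ)]
  refine tsum_congr fun n => ?_
  rw [← (measurePreserving_add_right volume (n : ℝ)).setLIntegral_comp_preimage
    measurableSet_Ioc hf]
  simp

/-- Parseval's identity for the samples, at the points of `t + ℤ`, of the Fourier transform of a
function supported on `[-1/2, 1/2]`. -/
theorem hasSum_sq_norm_integral_cexp {g : ℝ → ℂ} (hg : Continuous g) (t : ℝ) :
    HasSum (fun n : ℤ => ‖∫ ξ in (-(1 / 2) : ℝ)..(1 / 2),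
        Complex.exp ((-(2 * Real.pi * (t + n) * ξ) : ℝ) * Complex.I) * g ξ‖ ^ 2)
      (∫ ξ in (-(1 / 2) : ℝ)..(1 / 2), ‖g ξ‖ ^ 2) := by
  set f : ℝ → ℂ := fun ξ => Complex.exp ((-(2 * Real.pi * t * ξ) : ℝ) * Complex.I) * g ξ with hf
  have hfc : Continuous f := by fun_prop
  have hab : (-(1 / 2) : ℝ) < 1 / 2 := by norm_num
  have hL2 : MemLp f 2 (volume.restrict (Set.Ioc (-(1 / 2) : ℝ) (1 / 2))) :=
    (memLp_two_iff_integrable_sq_norm hfc.aestronglyMeasurable).2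
      ((hfc.norm.pow 2).integrableOn_Ioc)
  have h := hasSum_sq_fourierCoeffOn hab hL2
  have hnorm (ξ : ℝ) : ‖f ξ‖ = ‖g ξ‖ := by
    simp only [hf, norm_mul, Complex.norm_exp_ofReal_mul_I, one_mul]
  have hone : (1 / 2 : ℝ) - -(1 / 2) = 1 := by norm_num
  simp only [hnorm, fourierCoeffOn_eq_integral, fourier_coe_apply] at h
  convert h using 1
  · funext n
    rw [hone, div_one, one_smul]
    congr 3
    funext ξ
    rw [smul_eq_mul, hf, ← mul_assoc, ← Complex.exp_add]
    congr 2
    push_cast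
    ring
  · rw [hone, inv_one, one_smul]

/-- Plancherel's identity for a function supported on `[-1/2, 1/2]`. -/
theorem lintegral_sq_enorm_integral_cexp {g h : ℝ → ℂ} (hg : Continuous g) (hh : Measurable h)
    (hgh : ∀ t, h t = ∫ ξ in (-(1 / 2) : ℝ)..(1 / 2),
      Complex.exp ((-(2 * Real.pi * t * ξ) : ℝ) * Complex.I) * g ξ) :
    ∫⁻ t, ‖h t‖ₑ ^ 2 = ENNReal.ofReal (∫ ξ in (-(1 / 2) : ℝ)..(1 / 2), ‖g ξ‖ ^ 2) := by
  rw [lintegral_eq_lintegral_tsum_add_intCast (by fun_prop)]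
  have key (t : ℝ) : ∑' n : ℤ, ‖h (t + n)‖ₑ ^ 2
      = ENNReal.ofReal (∫ ξ in (-(1 / 2) : ℝ)..(1 / 2), ‖g ξ‖ ^ 2) := by
    have hs := hasSum_sq_norm_integral_cexp hg t
    rw [← hs.tsum_eq, ENNReal.ofReal_tsum_of_nonneg (fun _ => sq_nonneg _) hs.summable]
    refine tsum_congr fun n => ?_
    rw [← hgh, ENNReal.ofReal_pow (norm_nonneg _), ofReal_norm]
  simp [key]

theorem sq_norm_sum_mul_le {ι : Type*} (s : Finset ι) (c z : ι → ℂ)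
    (hc : ∑ n ∈ s, ‖c n‖ ^ 2 ≤ 1) :
    ‖∑ n ∈ s, c n * z n‖ ^ 2 ≤ ∑ n ∈ s, ‖z n‖ ^ 2 :=
  calc ‖∑ n ∈ s, c n * z n‖ ^ 2 ≤ (∑ n ∈ s, ‖c n‖ * ‖z n‖) ^ 2 := by
        gcongr
        exact norm_sum_le_of_le s fun n _ => norm_mul_le _ _
    _ ≤ (∑ n ∈ s, ‖c n‖ ^ 2) * ∑ n ∈ s, ‖z n‖ ^ 2 := Finset.sum_mul_sq_le_sq_mul_sq _ _ _
    _ ≤ ∑ n ∈ s, ‖z n‖ ^ 2 :=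
        mul_le_of_le_one_left (Finset.sum_nonneg fun _ _ => sq_nonneg _) hc

theorem integral_sq_norm_cexp_sub_cexp (x y : ℝ) :
    ∫ ξ in (-(1 / 2) : ℝ)..(1 / 2),
      ‖Complex.exp ((2 * Real.pi * x * ξ : ℝ) * Complex.I)
        - Complex.exp ((2 * Real.pi * y * ξ : ℝ) * Complex.I)‖ ^ 2
      = 2 * (1 - sincFun (x - y)) := by
  have h (ξ : ℝ) : ‖Complex.exp ((2 * Real.pi * x * ξ : ℝ) * Complex.I)
        - Complex.exp ((2 * Real.pi * y * ξ : ℝ) * Complex.I)‖ ^ 2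
      = 2 - 2 * Real.cos (2 * Real.pi * (x - y) * ξ) := by
    rw [sq_norm_cexp_sub_cexp]
    ring_nf
  simp only [h]
  rw [intervalIntegral.integral_sub (by simp)
    (Continuous.intervalIntegrable (by fun_prop) _ _),
    intervalIntegral.integral_const_mul, integral_cos_eq_sincFun]
  norm_num
  ring

/-- For any real sequence `(λ_n)_{n∈ℤ}` and any finitely supported complex `(c_n)` with
`Σ |c_n|² ≤ 1`, one has
`∫_ℝ |Σ_n c_n (sinc(λ_n - t) - sinc(n - t))|² dt ≤ 2 Σ_{n∈ℤ} (1 - sinc(λ_n - n))`.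
The right-hand side (a sum of nonnegative terms, possibly infinite) and the left-hand side
are interpreted in `ℝ≥0∞`. -/
theorem sinc_perturbation_bound (lam : ℤ → ℝ) (c : ℤ →₀ ℂ)
    (hc : (∑ n ∈ c.support, ‖c n‖ ^ 2) ≤ 1) :
    (∫⁻ t : ℝ,
        (‖∑ n ∈ c.support, c n * ((sincFun (lam n - t) : ℂ) - (sincFun ((n : ℝ) - t) : ℂ))‖₊ :
          ENNReal) ^ 2)
      ≤ 2 * ∑' n : ℤ, ENNReal.ofReal (1 - sincFun (lam n - n)) := by
  set e : ℝ → ℝ → ℂ := fun x ξ => Complex.exp ((2 * Real.pi * x * ξ : ℝ) * Complex.I) with he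
  have hec (x : ℝ) : Continuous (e x) := by fun_prop
  set g : ℝ → ℂ := fun ξ => ∑ n ∈ c.support, c n * (e (lam n) ξ - e n ξ) with hg
  have hgc : Continuous g := by fun_prop
  have hshift (x t ξ : ℝ) :
      Complex.exp ((-(2 * Real.pi * t * ξ) : ℝ) * Complex.I) * e x ξ = e (x - t) ξ := by
    simp only [he]
    rw [← Complex.exp_add]
    congr 1
    push_cast
    ring
  have hint (x : ℝ) : IntervalIntegrable (e x) volume (-(1 / 2)) (1 / 2) :=
    (hec x).intervalIntegrable _ _
  have hgh (t : ℝ) : ∑ n ∈ c.support,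
        c n * ((sincFun (lam n - t) : ℂ) - (sincFun ((n : ℝ) - t) : ℂ))
      = ∫ ξ in (-(1 / 2) : ℝ)..(1 / 2),
        Complex.exp ((-(2 * Real.pi * t * ξ) : ℝ) * Complex.I) * g ξ := by
    have hexp (ξ : ℝ) : Complex.exp ((-(2 * Real.pi * t * ξ) : ℝ) * Complex.I) * g ξ
        = ∑ n ∈ c.support, c n * (e (lam n - t) ξ - e (n - t) ξ) := by
      simp only [hg, Finset.mul_sum, ← hshift]
      exact Finset.sum_congr rfl fun n _ => by ring
    simp only [hexp]
    rw [intervalIntegral.integral_finsetSum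
      fun n _ => ((hint _).sub (hint _)).const_mul _]
    refine Finset.sum_congr rfl fun n _ => ?_
    rw [intervalIntegral.integral_const_mul, intervalIntegral.integral_sub (hint _) (hint _),
      integral_cexp_eq_sincFun, integral_cexp_eq_sincFun]
  have hbound : ∫ ξ in (-(1 / 2) : ℝ)..(1 / 2), ‖g ξ‖ ^ 2
      ≤ ∑ n ∈ c.support, 2 * (1 - sincFun (lam n - n)) := by
    simp only [← integral_sq_norm_cexp_sub_cexp]
    rw [← intervalIntegral.integral_finsetSum
      fun n _ => Continuous.intervalIntegrable (by fun_prop) _ _]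
    exact intervalIntegral.integral_mono_on (by norm_num)
      (Continuous.intervalIntegrable (by fun_prop) _ _)
      (Continuous.intervalIntegrable (by fun_prop) _ _)
      fun ξ _ => sq_norm_sum_mul_le _ _ _ hc
  have hmeas : Measurable fun t : ℝ => ∑ n ∈ c.support,
      c n * ((sincFun (lam n - t) : ℂ) - (sincFun ((n : ℝ) - t) : ℂ)) := by
    have := continuous_sincFun
    exact Continuous.measurable (by fun_prop)
  refine (lintegral_sq_enorm_integral_cexp hgc hmeas hgh).trans_le ?_
  refine (ENNReal.ofReal_le_ofReal hbound).trans ?_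
  rw [← Finset.mul_sum, ENNReal.ofReal_mul zero_le_two, ENNReal.ofReal_ofNat,
    ENNReal.ofReal_sum_of_nonneg fun n _ => sub_nonneg.2 (sincFun_le_one _)]
  gcongr
  exact ENNReal.sum_le_tsum _
end

section
/- For all n, m ∈ ℤ and every k ∈ ℕ, ∫_ℝ ((d^k/dt^k) sinc(t − n)) · ((d^k/dt^k) sinc(t − m)) dt = (1/(2π)) ∫_{−π}^{π} ξ^{2k} e^{i(m−n)ξ} dξ. -/
open MeasureTheory

open scoped FourierTransform SchwartzMap ContDiff ComplexInnerProductSpace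

/-- The Fourier transform of an element of `L²` that is also integrable is given by the Fourier
integral. -/
theorem MeasureTheory.Lp.coeFn_fourier_ae_eq_of_integrable (f : ℝ → ℂ) (hf : Integrable f)
    (hf2 : MemLp f 2) : ⇑(𝓕 (hf2.toLp f) : Lp ℂ 2 (volume : Measure ℝ)) =ᵐ[volume] 𝓕 f := by
  have hcont : Continuous (𝓕 f) :=
    VectorFourier.fourierIntegral_continuous Real.continuous_fourierChar
      continuous_inner hf
  refine ae_eq_of_integral_contDiff_smul_eq
    ((Lp.memLp _).locallyIntegrable one_le_two) hcont.locallyIntegrable ?_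
  intro g g_smooth g_cpt
  have hg₁ : HasCompactSupport (Complex.ofRealCLM ∘ g) := g_cpt.comp_left rfl
  have hg₂ : ContDiff ℝ ∞ (Complex.ofRealCLM ∘ g) := by fun_prop
  set φ : 𝓢(ℝ, ℂ) := hg₁.toSchwartzMap hg₂ with hφ
  have hφg (x : ℝ) : φ x = (g x : ℂ) := by simp [hφ]
  have h := congrArg (fun T => T φ)
    (Lp.fourier_toTemperedDistribution_eq (E := ℝ) (F := ℂ) (hf2.toLp f))
  simp only [TemperedDistribution.fourier_apply, Lp.toTemperedDistribution_apply] at h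
  have hL : ∫ x, (𝓕 φ) x • (hf2.toLp f) x = ∫ x, (𝓕 φ) x • f x :=
    integral_congr_ae (by filter_upwards [hf2.coeFn_toLp] with x hx; rw [hx])
  have hswap : ∫ x, (𝓕 φ) x • f x = ∫ x, φ x • 𝓕 f x := by
    have := VectorFourier.integral_fourierIntegral_smul_eq_flip (L := innerₗ ℝ)
      (μ := (volume : Measure ℝ)) (ν := (volume : Measure ℝ)) (f := φ) (g := f)
      Real.continuous_fourierChar continuous_inner φ.integrable hf
    rwa [flip_innerₗ] at this
  rw [hL, hswap] at h
  simp only [hφg, Complex.coe_smul] at h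
  exact h.symm

/-- Parseval's identity for Fourier integrals of functions in `L¹ ∩ L²`. -/
theorem integral_inner_fourier_eq_of_integrable {f g : ℝ → ℂ} (hf : Integrable f)
    (hf2 : MemLp f 2) (hg : Integrable g) (hg2 : MemLp g 2) :
    ∫ t, ⟪𝓕 f t, 𝓕 g t⟫ = ∫ x, ⟪f x, g x⟫ := by
  have h := Lp.inner_fourier_eq (hf2.toLp f) (hg2.toLp g)
  rw [L2.inner_def, L2.inner_def] at h
  calc
    _ = _ := integral_congr_ae (by
      filter_upwards [Lp.coeFn_fourier_ae_eq_of_integrable f hf hf2,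
        Lp.coeFn_fourier_ae_eq_of_integrable g hg hg2] with x hx hy
      rw [hx, hy])
    _ = _ := h
    _ = _ := integral_congr_ae (by
      filter_upwards [hf2.coeFn_toLp, hg2.coeFn_toLp] with x hx hy
      rw [hx, hy])

theorem iteratedDeriv_ofReal_comp {f : ℝ → ℝ} {k : ℕ} (hf : ContDiff ℝ k f) (t : ℝ) :
    iteratedDeriv k (fun s => (f s : ℂ)) t = ((iteratedDeriv k f t : ℝ) : ℂ) := by
  have h := Complex.ofRealCLM.iteratedFDeriv_comp_left (x := t) hf.contDiffAt le_rfl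
  rw [iteratedDeriv, iteratedDeriv]
  exact congrArg (fun T => T fun _ => (1 : ℝ)) h

/-- The character `x ↦ exp (2π i a x)` cut off to `(-1/2, 1/2]`, the spectrum of `sinc (· - a)`. -/
noncomputable def truncatedExp (a : ℝ) : ℝ → ℂ :=
  (Set.Ioc (-(1 / 2)) (1 / 2)).indicator fun x : ℝ => Complex.exp (2 * Real.pi * a * x * Complex.I)

theorem mul_truncatedExp (a : ℝ) (p : ℝ → ℂ) : (fun x => p x • truncatedExp a x) =
    (Set.Ioc (-(1 / 2) : ℝ) (1 / 2)).indicator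
      fun x : ℝ => p x * Complex.exp (2 * Real.pi * a * x * Complex.I) := by
  ext x
  simp only [truncatedExp, Set.indicator]
  split_ifs <;> simp

theorem memLp_mul_truncatedExp (a : ℝ) {p : ℝ → ℂ} (hp : Continuous p) (q : ENNReal) :
    MemLp (fun x => p x • truncatedExp a x) q := by
  rw [mul_truncatedExp, memLp_indicator_iff_restrict measurableSet_Ioc]
  have hc : Continuous fun x : ℝ => p x * Complex.exp (2 * Real.pi * a * x * Complex.I) := by
    fun_prop
  obtain ⟨C, hC⟩ := (isCompact_Icc (a := (-(1 / 2) : ℝ)) (b := 1 / 2)).exists_bound_of_continuousOn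
    hc.continuousOn
  exact MemLp.of_bound hc.aestronglyMeasurable C ((ae_restrict_mem measurableSet_Ioc).mono
    fun x hx => hC x (Set.Ioc_subset_Icc_self hx))

theorem integrable_mul_truncatedExp (a : ℝ) {p : ℝ → ℂ} (hp : Continuous p) :
    Integrable (fun x => p x • truncatedExp a x) :=
  memLp_one_iff_integrable.1 (memLp_mul_truncatedExp a hp 1)

theorem integrable_pow_smul_truncatedExp (a : ℝ) (j : ℕ) :
    Integrable (fun x : ℝ => x ^ j • truncatedExp a x) := by
  have h := integrable_mul_truncatedExp a (p := fun x : ℝ => ((x ^ j : ℝ) : ℂ)) (by fun_prop)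
  simpa only [Complex.coe_smul] using h

theorem fourier_truncatedExp (a t : ℝ) : 𝓕 (truncatedExp a) t = (sincFun (t - a) : ℂ) := by
  have h1 : 𝓕 (truncatedExp a) t = ∫ x in (-(1 / 2) : ℝ)..(1 / 2),
      Complex.exp (((2 * Real.pi * (a - t)) * x : ℝ) * Complex.I) := by
    rw [Real.fourier_real_eq_integral_exp_smul, mul_truncatedExp,
      integral_indicator measurableSet_Ioc, intervalIntegral.integral_of_le (by norm_num)]
    refine integral_congr_ae (Filter.Eventually.of_forall fun x => ?_)
    simp only
    rw [← Complex.exp_add]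
    congr 1
    push_cast
    ring
  rw [h1]
  by_cases hta : t - a = 0
  · have : a - t = 0 := by linarith
    simp [sincFun, hta, this]
    norm_num
  have hc : 2 * Real.pi * (a - t) ≠ 0 := by
    have := Real.pi_pos.ne'
    have : a - t ≠ 0 := fun h => hta (by linarith)
    positivity
  rw [intervalIntegral.integral_comp_mul_left (fun y : ℝ => Complex.exp (y * Complex.I)) hc]
  have e1 : 2 * Real.pi * (a - t) * -(1 / 2) = -(Real.pi * (a - t)) := by ring
  have e2 : 2 * Real.pi * (a - t) * (1 / 2) = Real.pi * (a - t) := by ring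
  rw [e1, e2, integral_exp_mul_I_eq_sinc, sincFun, if_neg hta, ← Real.sinc_neg,
    show -(Real.pi * (a - t)) = Real.pi * (t - a) by ring,
    Real.sinc_of_ne_zero (mul_ne_zero Real.pi_pos.ne' hta), Complex.real_smul]
  have hc' : (a : ℂ) - t ≠ 0 := by
    rw [← Complex.ofReal_sub]
    exact_mod_cast fun h => hta (by linarith)
  have hpi : (Real.pi : ℂ) ≠ 0 := by exact_mod_cast Real.pi_pos.ne'
  push_cast
  field_simp

theorem contDiff_sincFun_sub (a : ℝ) (k : ℕ) : ContDiff ℝ k (fun s => sincFun (s - a)) := by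
  have h : ContDiff ℝ (k : ℕ∞) (𝓕 (truncatedExp a)) := Real.contDiff_fourier fun j _ => by
    simpa [norm_smul] using (integrable_pow_smul_truncatedExp a j).norm
  have h2 := Complex.reCLM.contDiff.comp h
  have : (fun s => sincFun (s - a)) = Complex.reCLM ∘ 𝓕 (truncatedExp a) := by
    ext s
    simp [fourier_truncatedExp]
  rw [this]
  exact h2

theorem ofReal_iteratedDeriv_sincFun_sub (a t : ℝ) (k : ℕ) :
    ((iteratedDeriv k (fun s => sincFun (s - a)) t : ℝ) : ℂ) =
      𝓕 (fun x : ℝ => (-2 * Real.pi * Complex.I * x) ^ k • truncatedExp a x) t := by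
  rw [← iteratedDeriv_ofReal_comp (contDiff_sincFun_sub a k), ← Real.iteratedDeriv_fourier
    (N := (k : ℕ∞)) (fun j _ => integrable_pow_smul_truncatedExp a j) le_rfl]
  congr 1
  ext s
  rw [fourier_truncatedExp]

/-- For all `n, m ∈ ℤ` and `k ∈ ℕ`,
`∫_ℝ (d^k/dt^k sinc(t-n)) (d^k/dt^k sinc(t-m)) dt = (1/(2π)) ∫_{-π}^{π} ξ^{2k} e^{i(m-n)ξ} dξ`. -/
theorem iteratedDeriv_sinc_inner_product (n m : ℤ) (k : ℕ) :
    ((∫ t : ℝ, iteratedDeriv k (fun s : ℝ => sincFun (s - n)) t *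
        iteratedDeriv k (fun s : ℝ => sincFun (s - m)) t : ℝ) : ℂ)
      = (1 / (2 * Real.pi)) * ∫ ξ in (-Real.pi)..Real.pi,
          (ξ : ℂ) ^ (2 * k) * Complex.exp (Complex.I * ((m : ℂ) - n) * ξ) := by
  have hp : Continuous fun x : ℝ => (-2 * Real.pi * Complex.I * x : ℂ) ^ k := by fun_prop
  have hP := integral_inner_fourier_eq_of_integrable
    (integrable_mul_truncatedExp n hp) (memLp_mul_truncatedExp n hp 2)
    (integrable_mul_truncatedExp m hp) (memLp_mul_truncatedExp m hp 2)
  simp only [← ofReal_iteratedDeriv_sincFun_sub] at hP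
  have hL : ((∫ t : ℝ, iteratedDeriv k (fun s : ℝ => sincFun (s - n)) t *
      iteratedDeriv k (fun s : ℝ => sincFun (s - m)) t : ℝ) : ℂ) =
      ∫ t : ℝ, ⟪((iteratedDeriv k (fun s : ℝ => sincFun (s - n)) t : ℝ) : ℂ),
        ((iteratedDeriv k (fun s : ℝ => sincFun (s - m)) t : ℝ) : ℂ)⟫ := by
    rw [← integral_complex_ofReal]
    refine integral_congr_ae (Filter.Eventually.of_forall fun t => ?_)
    simp [mul_comm]
  rw [hL, hP]
  have hpi : (2 * Real.pi) ≠ 0 := by positivity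
  have hS := intervalIntegral.integral_comp_mul_left (a := -(1 / 2)) (b := 1 / 2)
    (fun ξ : ℝ => (ξ : ℂ) ^ (2 * k) * Complex.exp (Complex.I * ((m : ℂ) - n) * ξ)) hpi
  rw [show 2 * Real.pi * -(1 / 2) = -Real.pi by ring,
    show 2 * Real.pi * (1 / 2) = Real.pi by ring, Complex.real_smul] at hS
  rw [show (1 / (2 * Real.pi) : ℂ) = (((2 * Real.pi)⁻¹ : ℝ) : ℂ) by push_cast; ring, ← hS,
    intervalIntegral.integral_of_le (by norm_num), ← integral_indicator measurableSet_Ioc]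
  refine integral_congr_ae (Filter.Eventually.of_forall fun x => ?_)
  simp only [truncatedExp, Set.indicator]
  split_ifs with hx
  · simp only [RCLike.inner_apply, smul_eq_mul, map_mul, map_pow, ← Complex.exp_conj, map_neg,
      Complex.conj_ofReal, Complex.conj_I, map_ofNat]
    rw [mul_mul_mul_comm, ← Complex.exp_add, ← mul_pow, pow_mul]
    congr 2
    · push_cast
      linear_combination (-4 * (Real.pi : ℂ) ^ 2 * x ^ 2) * Complex.I_sq
    · push_cast
      ring
  · simp
end

section
/- For every real number λ, the series Σ_{k∈ℤ} sinc(λ − k) · sinc(k − t) converges in L²(ℝ) (as a function of t) to the function t ↦ sinc(λ − t); that is, the expansion sinc(λ − t) = Σ_{k∈ℤ} sinc(λ − k) sinc(k − t) holds in the L²(ℝ) sense. -/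
open MeasureTheory Filter

open scoped FourierTransform ContDiff SchwartzMap in
/-- The `L²` Fourier transform agrees almost everywhere with the Fourier integral on `L¹ ∩ L²`. -/
theorem fourier_toLp_ae_eq {f : ℝ → ℂ} (hf₁ : Integrable f) (hf₂ : MemLp f 2) :
    (𝓕 hf₂.toLp : Lp ℂ 2 (volume : Measure ℝ)) =ᵐ[volume] 𝓕 f := by
  have hcont : Continuous (𝓕 f) :=
    VectorFourier.fourierIntegral_continuous Real.continuous_fourierChar continuous_inner hf₁
  refine ae_eq_of_integral_contDiff_smul_eq
    ((Lp.memLp _).locallyIntegrable one_le_two) hcont.locallyIntegrable ?_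
  intro g g_smooth g_cpt
  have hg₁ : HasCompactSupport (Complex.ofRealCLM ∘ g) := g_cpt.comp_left rfl
  have hg₂ : ContDiff ℝ ∞ (Complex.ofRealCLM ∘ g) := by fun_prop
  set G : 𝓢(ℝ, ℂ) := hg₁.toSchwartzMap hg₂
  have key := congrArg (fun T ↦ T G) (Lp.fourier_toTemperedDistribution_eq (hf₂.toLp))
  simp only [TemperedDistribution.fourier_apply, Lp.toTemperedDistribution_apply] at key
  have hflip : ∫ x, 𝓕 (G : ℝ → ℂ) x • f x = ∫ x, G x • 𝓕 f x := by
    simpa using! VectorFourier.integral_fourierIntegral_smul_eq_flip (μ := volume) (ν := volume)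
      (L := innerₗ ℝ) Real.continuous_fourierChar continuous_inner G.integrable hf₁
  have hfLp : ∫ x, (𝓕 G) x • (hf₂.toLp : ℝ → ℂ) x = ∫ x, 𝓕 (G : ℝ → ℂ) x • f x := by
    refine integral_congr_ae ?_
    filter_upwards [hf₂.coeFn_toLp] with x hx
    rw [hx, SchwartzMap.fourier_coe]
  have hGg : ∀ x, G x = (g x : ℂ) := fun x ↦ rfl
  have := key.symm.trans (hfLp.trans hflip)
  simpa [hGg] using this

open scoped FourierTransform in
/-- **Plancherel's theorem** for the Fourier integral of a function in `L¹ ∩ L²`. -/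
theorem eLpNorm_fourier_eq {f : ℝ → ℂ} (hf₁ : Integrable f) (hf₂ : MemLp f 2) :
    eLpNorm (𝓕 f) 2 volume = eLpNorm f 2 volume := by
  rw [← eLpNorm_congr_ae (fourier_toLp_ae_eq hf₁ hf₂), ← eLpNorm_congr_ae hf₂.coeFn_toLp,
    ← Lp.enorm_def, ← Lp.enorm_def, enorm_eq_iff_norm_eq, Lp.norm_fourier_eq]

/-- The exponential `x ↦ exp (2πiax)`. -/
noncomputable def expWave (a x : ℝ) : ℂ := Complex.exp (2 * Real.pi * Complex.I * a * x)

theorem continuous_expWave (a : ℝ) : Continuous (expWave a) := by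
  unfold expWave; fun_prop

theorem expWave_sub (a b x : ℝ) : expWave (a - b) x = expWave (-b) x * expWave a x := by
  simp only [expWave, ← Complex.exp_add]
  congr 1
  push_cast
  ring

theorem integral_expWave (a : ℝ) :
    ∫ x in (-(1 / 2) : ℝ)..(-(1 / 2) + 1), expWave a x = sincFun a := by
  by_cases ha : a = 0
  · simp [expWave, sincFun, ha]
  have hπ : (Real.pi : ℂ) ≠ 0 := by exact_mod_cast Real.pi_ne_zero
  have haC : (a : ℂ) ≠ 0 := by exact_mod_cast ha
  have hc : 2 * Real.pi * Complex.I * a ≠ 0 := by simp [haC, hπ]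
  simp only [expWave]
  rw [integral_exp_mul_complex hc, sincFun, if_neg ha]
  push_cast
  rw [Complex.sin]
  have h₁ : 2 * Real.pi * Complex.I * a * (-(1 / 2) + 1) = Real.pi * a * Complex.I := by ring
  have h₂ : 2 * Real.pi * Complex.I * a * -(1 / 2) = -(Real.pi * a) * Complex.I := by ring
  rw [h₁, h₂]
  field_simp
  linear_combination (Complex.exp (Real.pi * a * Complex.I) -
    Complex.exp (-(Real.pi * a * Complex.I))) * Complex.I_sq

theorem fourier_coe_eq_expWave (n : ℤ) (x : ℝ) :
    fourier n (x : AddCircle (1 : ℝ)) = expWave n x := by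
  simp [expWave]

theorem fourierCoeff_liftIoc_expWave (a : ℝ) (n : ℤ) :
    fourierCoeff (AddCircle.liftIoc 1 (-(1 / 2)) (expWave a)) n = sincFun (a - n) := by
  rw [fourierCoeff_eq_intervalIntegral _ _ (-(1 / 2)), ← integral_expWave]
  simp only [div_one, one_smul]
  refine intervalIntegral.integral_congr_ae (ae_of_all _ fun x hx ↦ ?_)
  rw [Set.uIoc_of_le (by norm_num)] at hx
  rw [AddCircle.liftIoc_coe_apply hx, fourier_coe_eq_expWave, expWave_sub, smul_eq_mul]
  simp

/-- The fundamental interval carrying the Fourier transform of `sincFun`. -/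
abbrev sincBand : Set ℝ := Set.Ioc (-(1 / 2)) (-(1 / 2) + 1)

theorem memLp_expWave (a : ℝ) (p : ENNReal) : MemLp (expWave a) p (volume.restrict sincBand) :=
  MemLp.of_bound (continuous_expWave a).aestronglyMeasurable 1 <| ae_of_all _ fun x ↦ by
    rw [expWave, show (2 * Real.pi * Complex.I * a * x : ℂ) =
      ((2 * Real.pi * a * x : ℝ) : ℂ) * Complex.I by push_cast; ring,
      Complex.norm_exp_ofReal_mul_I]

/-- The error of a partial sum of the Fourier series of `expWave a` on `sincBand`. -/
noncomputable def expWaveError (a : ℝ) (s : Finset ℤ) (x : ℝ) : ℂ :=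
  expWave a x - ∑ k ∈ s, (sincFun (a - k) : ℂ) * expWave k x

theorem memLp_expWaveError (a : ℝ) (s : Finset ℤ) (p : ENNReal) :
    MemLp (expWaveError a s) p (volume.restrict sincBand) :=
  (memLp_expWave a p).sub <| memLp_finsetSum _ fun k _ ↦ (memLp_expWave k p).const_mul _

theorem tendsto_eLpNorm_expWaveError (a : ℝ) :
    Tendsto (fun s ↦ eLpNorm (expWaveError a s) 2 (volume.restrict sincBand)) atTop (nhds 0) := by
  have hmem : MemLp (AddCircle.liftIoc 1 (-(1 / 2)) (expWave a)) 2
      (AddCircle.haarAddCircle (T := (1 : ℝ))) :=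
    (memLp_expWave a 2).memLp_liftIoc.haarAddCircle
  have hsum := hasSum_fourier_series_L2 hmem.toLp
  rw [HasSum, SummationFilter.unconditional_filter, Lp.tendsto_Lp_iff_tendsto_eLpNorm] at hsum
  refine hsum.congr fun s ↦ ?_
  have hcoe : ∀ᵐ y ∂(AddCircle.haarAddCircle (T := (1 : ℝ))), ∀ k ∈ s,
      (fourierCoeff hmem.toLp k • fourierLp 2 k : Lp ℂ 2 _) y =
        (sincFun (a - k) : ℂ) * fourier k y := by
    refine (ae_ball_iff s.countable_toSet).2 fun k _ ↦ ?_
    filter_upwards [Lp.coeFn_smul (fourierCoeff hmem.toLp k) (fourierLp (T := (1 : ℝ)) 2 k),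
      coeFn_fourierLp (T := (1 : ℝ)) 2 k] with y h₁ h₂
    rw [h₁, Pi.smul_apply, h₂, fourierCoeff_congr_ae hmem.coeFn_toLp,
      fourierCoeff_liftIoc_expWave, smul_eq_mul]
  have hae : ⇑(∑ k ∈ s, fourierCoeff hmem.toLp k • fourierLp 2 k : Lp ℂ 2 _) -
        AddCircle.liftIoc 1 (-(1 / 2)) (expWave a) =ᵐ[AddCircle.haarAddCircle (T := (1 : ℝ))]
      fun y ↦ ∑ k ∈ s, (sincFun (a - k) : ℂ) * fourier k y -
        AddCircle.liftIoc 1 (-(1 / 2)) (expWave a) y := by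
    filter_upwards [Lp.coeFn_fun_finsetSum s fun k ↦
      (fourierCoeff hmem.toLp k • fourierLp 2 k : Lp ℂ 2 _), hcoe] with y h₁ h₂
    rw [Pi.sub_apply, h₁, Finset.sum_congr rfl h₂]
  have hvol : AddCircle.haarAddCircle (T := (1 : ℝ)) = volume := by
    simp [AddCircle.volume_eq_smul_haarAddCircle]
  have hmeas := hmem.aestronglyMeasurable
  rw [eLpNorm_congr_ae hae]
  rw [hvol] at hmeas ⊢
  rw [← eLpNorm_comp_measurePreserving
    (by fun_prop) (AddCircle.measurePreserving_mk (1 : ℝ) (-(1 / 2)))]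
  refine eLpNorm_congr_norm_ae ?_
  filter_upwards [ae_restrict_mem measurableSet_Ioc] with x hx
  rw [Function.comp_apply, AddCircle.liftIoc_coe_apply hx, norm_sub_rev, expWaveError]
  simp only [fourier_coe_eq_expWave]

open scoped FourierTransform in
theorem fourier_indicator_expWaveError (a : ℝ) (s : Finset ℤ) (t : ℝ) :
    𝓕 (sincBand.indicator (expWaveError a s)) t =
      ((sincFun (a - t) - ∑ k ∈ s, sincFun (a - k) * sincFun (k - t) : ℝ) : ℂ) := by
  have hint : ∀ b, IntervalIntegrable (expWave b) volume (-(1 / 2)) (-(1 / 2) + 1) :=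
    fun b ↦ (continuous_expWave b).intervalIntegrable _ _
  have hexp : ∀ x, Real.fourierChar (-(x * t)) • sincBand.indicator (expWaveError a s) x =
      sincBand.indicator (fun x ↦ expWave (a - t) x -
        ∑ k ∈ s, (sincFun (a - k) : ℂ) * expWave (k - t) x) x := by
    intro x
    by_cases hx : x ∈ sincBand
    · rw [Set.indicator_of_mem hx, Set.indicator_of_mem hx, Circle.smul_def,
        Real.fourierChar_apply, expWaveError, smul_eq_mul, mul_sub, Finset.mul_sum]
      have he : Complex.exp (↑(2 * Real.pi * -(x * t)) * Complex.I) = expWave (-t) x := by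
        rw [expWave]
        congr 1
        push_cast
        ring
      rw [he, expWave_sub]
      congr 1
      refine Finset.sum_congr rfl fun k _ ↦ ?_
      rw [expWave_sub]
      ring
    · simp [Set.indicator_of_notMem hx]
  rw [Real.fourier_real_eq]
  simp only [hexp]
  rw [integral_indicator measurableSet_Ioc, ← intervalIntegral.integral_of_le (by norm_num),
    intervalIntegral.integral_sub (hint _) (Continuous.intervalIntegrable
      (continuous_finsetSum _ fun k _ ↦ (continuous_expWave _).const_mul _) _ _),
    intervalIntegral.integral_finsetSum fun k _ ↦ (hint _).const_mul _]
  simp only [intervalIntegral.integral_const_mul, integral_expWave]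
  push_cast
  rfl

/-- For every real `λ`, the expansion `sinc(λ - t) = Σ_{k∈ℤ} sinc(λ - k) sinc(k - t)` holds in
the `L²(ℝ)` sense: the `L²` norm of the difference between `sinc(λ - ·)` and the partial sums
tends to `0` along the net of finite subsets of `ℤ`. -/
theorem sinc_expansion_L2 (lam : ℝ) :
    Tendsto (fun s : Finset ℤ =>
        eLpNorm (fun t : ℝ =>
          sincFun (lam - t) - ∑ k ∈ s, sincFun (lam - k) * sincFun ((k : ℝ) - t)) 2 volume)
      atTop (nhds 0) := by
  refine (tendsto_eLpNorm_expWaveError lam).congr fun s ↦ ?_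
  have h₁ : Integrable (sincBand.indicator (expWaveError lam s)) :=
    (integrable_indicator_iff measurableSet_Ioc).2
      (memLp_one_iff_integrable.1 (memLp_expWaveError lam s 1))
  have h₂ : MemLp (sincBand.indicator (expWaveError lam s)) 2 :=
    (memLp_indicator_iff_restrict measurableSet_Ioc).2 (memLp_expWaveError lam s 2)
  rw [← eLpNorm_indicator_eq_eLpNorm_restrict measurableSet_Ioc, ← eLpNorm_fourier_eq h₁ h₂]
  refine eLpNorm_congr_norm_ae (ae_of_all _ fun t ↦ ?_)
  rw [fourier_indicator_expWaveError, Complex.norm_real]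
end

section
/- The unique positive real number α satisfying e^α = 2α + 1 (the Lamb–Oseen constant) is transcendental over ℚ. -/
open Polynomial

/-- Clearing denominators in the value of an integer polynomial. -/
theorem isIntegral_pow_mul_aeval {K : Type*} [Field K] {d : ℤ} {s : K}
    (hs : IsIntegral ℤ ((d : K) * s)) {g : ℤ[X]} {k : ℕ} (hg : g.natDegree ≤ k) :
    IsIntegral ℤ ((d : K) ^ k * aeval s g) := by
  rw [aeval_eq_sum_range' (Nat.lt_succ_of_le hg), Finset.mul_sum]
  refine IsIntegral.sum _ fun i hi => ?_
  have hik : i ≤ k := Nat.lt_succ_iff.mp (Finset.mem_range.mp hi)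
  have h : (d : K) ^ k * g.coeff i • s ^ i =
      algebraMap ℤ K (g.coeff i * d ^ (k - i)) * ((d : K) * s) ^ i := by
    rw [← Nat.sub_add_cancel hik]
    simp only [zsmul_eq_mul, pow_add, Nat.add_sub_cancel, eq_intCast, Int.cast_mul, Int.cast_pow]
    ring
  rw [h]
  exact isIntegral_algebraMap.mul (hs.pow i)

/-- Finitely many nonzero algebraic numbers are roots of one integer polynomial which does not
vanish at `0`. -/
theorem exists_eval_zero_ne_zero_forall_aeval_eq_zero {K : Type*} [Field K]
    (S : Finset K) (hS : ∀ s ∈ S, IsAlgebraic ℤ s ∧ s ≠ 0) :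
    ∃ f : ℤ[X], f.eval 0 ≠ 0 ∧ ∀ s ∈ S, aeval s f = 0 := by
  have h (s : K) : ∃ q : ℤ[X], q.eval 0 ≠ 0 ∧ (s ∈ S → aeval s q = 0) := by
    by_cases hs : s ∈ S
    · obtain ⟨q, hq, hq'⟩ := (hS s hs).1.exists_nonzero_coeff_and_aeval_eq_zero
        (mem_nonZeroDivisors_of_ne_zero (hS s hs).2)
      exact ⟨q, by rwa [← coeff_zero_eq_eval_zero], fun _ => hq'⟩
    · exact ⟨1, by simp, fun h => absurd h hs⟩
  choose q hq hq' using h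
  refine ⟨∏ s ∈ S, q s, ?_, fun s hs => ?_⟩
  · rw [eval_prod]
    exact Finset.prod_ne_zero_iff.mpr fun s _ => hq s
  · rw [map_prod]
    exact Finset.prod_eq_zero hs (hq' s hs)

/-- In a Galois number field, a Galois-invariant integral element is an integer. -/
theorem exists_intCast_eq_of_isIntegral_of_fixed {K : Type*} [Field K] [Algebra ℚ K]
    [FiniteDimensional ℚ K] [IsGalois ℚ K] {x : K} (hx : IsIntegral ℤ x)
    (hfix : ∀ σ : K ≃ₐ[ℚ] K, σ x = x) : ∃ t : ℤ, (t : K) = x := by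
  obtain ⟨y, rfl⟩ := (IsGalois.mem_range_algebraMap_iff_fixed x).mpr hfix
  have hy : IsIntegral ℤ y :=
    (isIntegral_algebraMap_iff (algebraMap ℚ K).injective).mp hx
  obtain ⟨t, rfl⟩ := IsIntegrallyClosed.isIntegral_iff.mp hy
  exact ⟨t, by simp⟩

/-- For any constants, there are arbitrarily large primes `p` with `W * B ^ p / (p - 1)! < 1`. -/
theorem exists_prime_mul_pow_div_factorial_lt_one (W B : ℝ) (m : ℕ) :
    ∃ p > m, p.Prime ∧ W * (B ^ p / (p - 1).factorial) < 1 := by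
  have h := (FloorSemiring.tendsto_pow_div_factorial_atTop B).const_mul (W * B)
  rw [mul_zero] at h
  obtain ⟨N, hN⟩ := Filter.eventually_atTop.mp (h.eventually_lt_const one_pos)
  obtain ⟨p, hp, hp'⟩ := Nat.exists_infinite_primes (N + m + 1)
  refine ⟨p, by omega, hp', ?_⟩
  have := hN (p - 1) (by omega)
  have hB : B ^ p = B * B ^ (p - 1) := (mul_pow_sub_one hp'.ne_zero B).symm
  rw [hB]
  calc _ = W * B * (B ^ (p - 1) / (p - 1).factorial) := by ring
    _ < 1 := this

/-- A Galois-invariant integer combination of exponentials of elements of a Galois number field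
is nonzero as soon as the coefficient of `exp 0` is nonzero. -/
theorem sum_smul_exp_ne_zero_of_fixed {K : Type*} [Field K] [Algebra ℚ K]
    [FiniteDimensional ℚ K] [IsGalois ℚ K] (φ : K →+* ℂ) (w : K →₀ ℤ)
    (hw : ∀ (σ : K ≃ₐ[ℚ] K) (s : K), w (σ s) = w s) (hw0 : w 0 ≠ 0) :
    w.sum (fun s c => (c : ℂ) * Complex.exp (φ s)) ≠ 0 := by
  classical
  intro hsum
  have : CharZero K := algebraRat.charZero K
  set S := w.support.erase 0 with hS
  have hwS (σ : K ≃ₐ[ℚ] K) (s : K) (hs : s ∈ S) : σ s ∈ S := by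
    rw [hS, Finset.mem_erase, Finsupp.mem_support_iff] at hs ⊢
    exact ⟨by simpa using hs.1, by rw [hw]; exact hs.2⟩
  have halg (s : K) : IsAlgebraic ℤ s :=
    (IsFractionRing.isAlgebraic_iff ℤ ℚ K).mpr (Algebra.IsAlgebraic.isAlgebraic s)
  obtain ⟨f, hf0, hf⟩ := exists_eval_zero_ne_zero_forall_aeval_eq_zero S
    fun s hs => ⟨halg s, (Finset.mem_erase.mp hs).1⟩
  obtain ⟨d, hd0, hd⟩ := exists_integral_multiples ℤ ℚ S
  obtain ⟨c, hc⟩ := LindemannWeierstrass.exp_polynomial_approx f hf0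
  obtain ⟨p, hp, hprime, hlt⟩ := exists_prime_mul_pow_div_factorial_lt_one
    (∑ s ∈ S, ‖(w s : ℂ)‖) (‖(d : ℂ)‖ ^ f.natDegree * c)
    ((f.eval 0).natAbs + d.natAbs + (w 0).natAbs)
  obtain ⟨n, hn, g, hg, hbound⟩ := hc p (by omega) hprime
  set k := p * f.natDegree with hk
  obtain ⟨t, ht⟩ : ∃ t : ℤ, (t : K) = (d : K) ^ k * ∑ s ∈ S, (w s : K) * aeval s g := by
    refine exists_intCast_eq_of_isIntegral_of_fixed ?_ fun σ => ?_
    · rw [Finset.mul_sum]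
      refine IsIntegral.sum _ fun s hs => ?_
      rw [mul_left_comm]
      have h := isIntegral_pow_mul_aeval (g := g) (k := k) (by simpa using hd s hs) (by omega)
      simpa using (isIntegral_algebraMap (R := ℤ) (A := K) (x := w s)).mul h
    · rw [map_mul, map_pow, map_intCast, map_sum]
      congr 1
      refine Finset.sum_bij (fun s _ => σ s) (fun s hs => hwS σ s hs)
        (fun _ _ _ _ h => σ.injective h)
        (fun s hs => ⟨σ.symm s, hwS _ s hs, by simp⟩) fun s _ => ?_
      rw [map_mul, map_intCast, hw]
      congr 1
      exact (aeval_algHom_apply (σ.toAlgHom.restrictScalars ℤ) s g).symm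
  have hexp : (w 0 : ℂ) + ∑ s ∈ S, (w s : ℂ) * Complex.exp (φ s) = 0 := by
    rw [← hsum, Finsupp.sum, ← Finset.add_sum_erase _ _ (Finsupp.mem_support_iff.mpr hw0)]
    simp [hS]
  have htC : (t : ℂ) = (d : ℂ) ^ k * ∑ s ∈ S, (w s : ℂ) * aeval (φ s) g := by
    have h := congrArg φ ht
    simp only [map_intCast, map_mul, map_pow, map_sum] at h
    rw [h]
    congr 1
    refine Finset.sum_congr rfl fun s _ => ?_
    congr 1
    exact (aeval_algHom_apply φ.toIntAlgHom s g).symm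
  have hNC : ((d ^ k * (n * w 0) + p * t : ℤ) : ℂ) =
      -((d : ℂ) ^ k * ∑ s ∈ S, (w s : ℂ) *
        (n • Complex.exp (φ s) - p • aeval (φ s) g)) := by
    have h1 : ∑ s ∈ S, (w s : ℂ) * (n • Complex.exp (φ s) - p • aeval (φ s) g) =
        n * ∑ s ∈ S, (w s : ℂ) * Complex.exp (φ s) -
          p * ∑ s ∈ S, (w s : ℂ) * aeval (φ s) g := by
      rw [Finset.mul_sum, Finset.mul_sum, ← Finset.sum_sub_distrib]
      refine Finset.sum_congr rfl fun s _ => ?_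
      simp only [zsmul_eq_mul, nsmul_eq_mul]
      ring
    push_cast
    rw [h1, htC]
    linear_combination ((d : ℂ) ^ k * n) * hexp
  have hNlt : ‖((d ^ k * (n * w 0) + p * t : ℤ) : ℂ)‖ < 1 := by
    rw [hNC, norm_neg, norm_mul, norm_pow]
    refine lt_of_le_of_lt ?_ hlt
    have h2 : ‖∑ s ∈ S, (w s : ℂ) * (n • Complex.exp (φ s) - p • aeval (φ s) g)‖ ≤
        ∑ s ∈ S, ‖(w s : ℂ)‖ * (c ^ p / (p - 1).factorial) := by
      refine norm_sum_le_of_le _ fun s hs => ?_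
      rw [norm_mul]
      refine mul_le_mul_of_nonneg_left (hbound ?_) (norm_nonneg _)
      rw [mem_aroots]
      refine ⟨by rintro rfl; simp at hf0, ?_⟩
      have h := aeval_algHom_apply φ.toIntAlgHom s f
      rw [hf s hs, map_zero] at h
      exact h
    refine (mul_le_mul_of_nonneg_left h2 (by positivity)).trans_eq ?_
    rw [← Finset.sum_mul, hk, mul_comm p, pow_mul, mul_pow]
    ring
  have hp' : Prime (p : ℤ) := Nat.prime_iff_prime_int.mp hprime
  have hndvd {x : ℤ} (hx : x ≠ 0) (hxp : x.natAbs < p) : ¬ (p : ℤ) ∣ x := fun h =>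
    absurd (Nat.le_of_dvd (Int.natAbs_pos.mpr hx) (Int.natCast_dvd.mp h)) (by omega)
  have hN0 : d ^ k * (n * w 0) + p * t ≠ 0 := by
    intro h0
    have h3 : (p : ℤ) ∣ d ^ k * (n * w 0) :=
      (dvd_add_left (dvd_mul_right (p : ℤ) t)).mp (h0 ▸ dvd_zero _)
    rcases hp'.dvd_or_dvd h3 with h | h
    · exact hndvd hd0 (by omega) (hp'.dvd_of_dvd_pow h)
    · rcases hp'.dvd_or_dvd h with h | h
      · exact hn h
      · exact hndvd hw0 (by omega) h
  rw [Complex.norm_intCast] at hNlt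
  exact absurd (Int.one_le_abs hN0) (by rw [not_le]; exact_mod_cast hNlt)

/-- Evaluation of formal integer combinations of exponentials. -/
noncomputable def expEval {K : Type*} [Field K] (φ : K →+* ℂ) :
    AddMonoidAlgebra ℤ K →ₐ[ℤ] ℂ :=
  AddMonoidAlgebra.lift ℤ ℂ K
    { toFun := fun s => Complex.exp (φ s.toAdd)
      map_one' := by simp
      map_mul' := fun s t => by simp [Complex.exp_add] }

theorem expEval_apply {K : Type*} [Field K] (φ : K →+* ℂ) (z : AddMonoidAlgebra ℤ K) :
    expEval φ z = z.coeff.sum fun s c => (c : ℂ) * Complex.exp (φ s) := by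
  simp [expEval, AddMonoidAlgebra.lift_apply]

theorem expEval_single {K : Type*} [Field K] (φ : K →+* ℂ) (s : K) :
    expEval φ (AddMonoidAlgebra.single s 1) = Complex.exp (φ s) := by
  simp [expEval]

/-- A nonzero Galois-invariant formal integer combination of exponentials has nonzero value. -/
theorem expEval_ne_zero_of_fixed {K : Type*} [Field K] [Algebra ℚ K]
    [FiniteDimensional ℚ K] [IsGalois ℚ K] (φ : K →+* ℂ) {z : AddMonoidAlgebra ℤ K}
    (hz : z ≠ 0) (hfix : ∀ (σ : K ≃ₐ[ℚ] K) (s : K), z.coeff (σ s) = z.coeff s) :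
    expEval φ z ≠ 0 := by
  intro h0
  obtain ⟨s₀, hs₀⟩ : ∃ s, z.coeff s ≠ 0 := by
    by_contra! h
    exact hz (AddMonoidAlgebra.ext (Finsupp.ext h))
  set y : AddMonoidAlgebra ℤ K := ∑ τ : K ≃ₐ[ℚ] K, AddMonoidAlgebra.single (-τ s₀) 1
  have hcoeff (s : K) : (z * y).coeff s = ∑ τ : K ≃ₐ[ℚ] K, z.coeff (s + τ s₀) := by
    simp [y, Finset.mul_sum, AddMonoidAlgebra.coeff_sum]
  refine sum_smul_exp_ne_zero_of_fixed φ (z * y).coeff (fun σ s => ?_) ?_ ?_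
  · rw [hcoeff, hcoeff]
    refine (Fintype.sum_equiv (Equiv.mulLeft σ) _ _ fun τ => ?_).symm
    simp only [Equiv.coe_mulLeft, AlgEquiv.mul_apply, ← map_add, hfix]
  · rw [hcoeff]
    simp [hfix, hs₀]
  · rw [← expEval_apply, map_mul, h0, zero_mul]

theorem coeff_zero_aeval_single {K : Type*} [Field K] [CharZero K] {s : K} (hs : s ≠ 0)
    (P : ℤ[X]) :
    (aeval (AddMonoidAlgebra.single s (1 : ℤ)) P : AddMonoidAlgebra ℤ K).coeff 0 =
      P.coeff 0 := by
  rw [aeval_eq_sum_range, AddMonoidAlgebra.coeff_sum, Finsupp.finsetSum_apply,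
    Finset.sum_eq_single 0]
  · simp [AddMonoidAlgebra.intCast_def]
  · intro i _ hi
    simp [AddMonoidAlgebra.single_pow, hi, hs]
  · simp

/-- **Hermite–Lindemann theorem**, for an element of a Galois number field. -/
theorem not_isAlgebraic_exp_of_galois {K : Type*} [Field K] [Algebra ℚ K]
    [FiniteDimensional ℚ K] [IsGalois ℚ K] (φ : K →+* ℂ) {s : K} (hs : s ≠ 0) :
    ¬ IsAlgebraic ℤ (Complex.exp (φ s)) := by
  intro halg
  have : CharZero K := algebraRat.charZero K
  obtain ⟨P, hP0, hP⟩ := halg.exists_nonzero_coeff_and_aeval_eq_zero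
    (mem_nonZeroDivisors_of_ne_zero (Complex.exp_ne_zero _))
  set z : AddMonoidAlgebra ℤ K :=
    ∏ τ : K ≃ₐ[ℚ] K, aeval (AddMonoidAlgebra.single (τ s) (1 : ℤ)) P with hz
  refine expEval_ne_zero_of_fixed φ (z := z) ?_ (fun σ x => ?_) ?_
  · refine Finset.prod_ne_zero_iff.mpr fun τ _ h => hP0 ?_
    rw [← coeff_zero_aeval_single (s := τ s) (by simpa using hs) P, h]
    simp
  · let Φ := AddMonoidAlgebra.domCongr ℤ ℤ (σ : K ≃+ K)
    have hΦ : Φ z = z := by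
      rw [hz, map_prod]
      refine Fintype.prod_equiv (Equiv.mulLeft σ) _ _ fun τ => ?_
      have h := aeval_algHom_apply Φ.toAlgHom (AddMonoidAlgebra.single (τ s) (1 : ℤ)) P
      refine h.symm.trans ?_
      simp [Φ]
      rfl
    conv_lhs => rw [← hΦ]
    simp [Φ]
  · rw [hz, map_prod]
    refine Finset.prod_eq_zero (Finset.mem_univ 1) ?_
    rw [← aeval_algHom_apply, expEval_single]
    exact hP

/-- **Hermite–Lindemann theorem**: the exponential of a nonzero algebraic number is
transcendental. -/
theorem transcendental_cexp_of_isAlgebraic {a : ℂ} (ha : a ≠ 0) (halg : IsAlgebraic ℚ a) :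
    Transcendental ℚ (Complex.exp a) := by
  intro hexp
  let K := IntermediateField.adjoin ℚ ((minpoly ℚ a).rootSet ℂ)
  have : (minpoly ℚ a).IsSplittingField ℚ K :=
    IntermediateField.adjoin_rootSet_isSplittingField (IsAlgClosed.splits _)
  have : FiniteDimensional ℚ K := IsSplittingField.finiteDimensional K (minpoly ℚ a)
  have : IsGalois ℚ K := { to_normal := Normal.of_isSplittingField (minpoly ℚ a) }
  have haK : a ∈ K := IntermediateField.subset_adjoin _ _
    ((mem_rootSet_of_ne (minpoly.ne_zero halg.isIntegral)).mpr (minpoly.aeval ℚ a))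
  exact not_isAlgebraic_exp_of_galois (algebraMap K ℂ) (s := ⟨a, haK⟩)
    (by simpa [← Subtype.coe_ne_coe] using ha)
    ((IsFractionRing.isAlgebraic_iff ℤ ℚ ℂ).mpr hexp)

/-- The Lamb–Oseen constant, the unique positive real `α` with `e^α = 2α + 1`, is
transcendental over `ℚ`. -/
theorem lambOseen_transcendental (a : ℝ) (ha : 0 < a) (hae : Real.exp a = 2 * a + 1) :
    Transcendental ℚ a := by
  intro halg
  have hC : IsAlgebraic ℚ (a : ℂ) := halg.algebraMap
  refine transcendental_cexp_of_isAlgebraic (by exact_mod_cast ha.ne') hC ?_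
  rw [← Complex.ofReal_exp, hae]
  have h2 : IsAlgebraic ℚ (2 : ℂ) := by
    simpa using isAlgebraic_algebraMap (R := ℚ) (A := ℂ) 2
  simpa using (h2.mul hC).add isAlgebraic_one
end
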